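/- Let p be a prime, F₀ a number field, and let V_p denote the set of places of F₀ above p. Define a probability weight on V_p by Pr(v) = [F₀ᵥ : ℚ_p]/[F₀ : ℚ] (these weights sum to 1), and give V_p^r the product probability. Fix an integer r ≥ 1 and, for each v ∈ V_p, an element t_v ∈ F₀ᵥ× with valuation ord_v(t_v). For each tuple v⃗ = (v₀, …, v_{r−1}) ∈ V_p^r, let T_{v⃗} = F₀_{v₀} ⊗_{ℚ_p} ⋯ ⊗_{ℚ_p} F₀_{v_{r−1}} with its natural topology as a finite-dimensional ℚ_p-vector space, let μ_{v⃗} be an additive Haar measure on T_{v⃗}, and let U_{v⃗} ⊆ T_{v⃗} be a measurable set with μ_{v⃗}(U_{v⃗}) = 1. Let t_{v_{r−1}} act on T_{v⃗} through the last tensor factor (i.e. by id ⊗ ⋯ ⊗ id ⊗ multiplication by t_{v_{r−1}}). Then Σ_{v⃗ ∈ V_p^r} Pr(v⃗) · (log μ_{v⃗}(t_{v_{r−1}} · U_{v⃗}) / dim_{ℚ_p} T_{v⃗}) = −(1/[F₀ : ℚ]) · Σ_{v ∈ V_p} ord_v(t_v) · log|κ(v)|, where Pr(v⃗) = Π_{i=0}^{r−1}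 Pr(v_i), ord_v is the valuation normalized so a uniformizer has valuation 1, and κ(v) is the residue field of v. -/

import Mathlib

open scoped Multiplicative TensorProduct
open IsDedekindDomain NumberField MeasureTheory

section A
open WithZero

lemma s7_hensel (p : ℕ) [Fact p.Prime] (l : ℕ) (hl : ¬ p ∣ l) (a : ℤ_[p]) :
    ∃ z : ℤ_[p], z ^ l = 1 + p * a := by
  have hl1 : ‖(l : ℤ_[p])‖ = 1 := by
    rw [PadicInt.norm_def]
    push_cast
    exact Padic.norm_natCast_eq_one_iff.mpr
      ((Nat.Prime.coprime_iff_not_dvd Fact.out).mpr hl)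
  have hp1 : ‖(p : ℤ_[p])‖ < 1 := by
    rw [PadicInt.norm_p]
    exact inv_lt_one_of_one_lt₀ (by exact_mod_cast (Fact.out : p.Prime).one_lt)
  obtain ⟨z, hz, -⟩ := hensels_lemma (p := p) (R := ℤ_[p])
    (F := (Polynomial.X ^ l - Polynomial.C (1 + p * a) : Polynomial ℤ_[p])) (a := 1) (by
      have h1 : ‖(p : ℤ_[p]) * a‖ < 1 := by
        rw [norm_mul]
        exact (mul_le_of_le_one_right (norm_nonneg _) (PadicInt.norm_le_one a)).trans_lt hp1
      simpa [Polynomial.derivative_X_pow, hl1] using h1)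
  refine ⟨z, ?_⟩
  simpa [sub_eq_zero] using hz

lemma s7_Vint (p : ℕ) [Fact p.Prime] (V : Valuation ℚ_[p] ℤᵐ⁰) (hV : V (p : ℚ_[p]) < 1)
    (a : ℚ_[p]) (ha : ‖a‖ ≤ 1) : V a ≤ 1 := by
  by_contra! h
  have hp0 : V (p : ℚ_[p]) ≠ 0 := by
    rw [Valuation.ne_zero_iff]
    exact_mod_cast (Fact.out : p.Prime).ne_zero
  have ha0 : V a ≠ 0 := fun h0 => by simp [h0] at h
  obtain ⟨k, hk⟩ : ∃ k : ℤ, V a = exp k := ⟨_, (exp_log ha0).symm⟩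
  obtain ⟨e, he⟩ : ∃ e : ℤ, V (p : ℚ_[p]) = exp e := ⟨_, (exp_log hp0).symm⟩
  rw [hk, ← exp_zero, exp_lt_exp] at h
  rw [he, ← exp_zero, exp_lt_exp] at hV
  obtain ⟨l, hl, hlp⟩ := Nat.exists_infinite_primes (p + e.natAbs + 1)
  obtain ⟨z, hz⟩ := s7_hensel p l (by
    intro hd
    have := (Nat.prime_dvd_prime_iff_eq Fact.out hlp).mp hd
    omega) ((show ℤ_[p] from ⟨a, ha⟩) ^ l)
  have hz' : (z : ℚ_[p]) ^ l = 1 + p * a ^ l := by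
    have := congrArg (fun x : ℤ_[p] => (x : ℚ_[p])) hz
    push_cast at this
    have e1 : (((show ℤ_[p] from ⟨a, ha⟩) ^ l : ℤ_[p]) : ℚ_[p]) = a ^ l := PadicInt.coe_pow _ _
    rw [this, e1]
  have h2 : V (p * a ^ l) = exp (e + l * k) := by
    rw [map_mul, map_pow, hk, he, exp_add, ← exp_nsmul]; simp
  have h3 : V (z : ℚ_[p]) ^ l = exp (e + l * k) := by
    rw [← map_pow, hz', Valuation.map_add_eq_of_lt_right V, h2]
    rw [h2, map_one, ← exp_zero, exp_lt_exp]
    nlinarith [abs_of_neg hV, Int.natCast_natAbs e]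
  have hz0 : V (z : ℚ_[p]) ≠ 0 := fun h0 => by
    rw [h0, zero_pow hlp.ne_zero] at h3
    exact exp_ne_zero h3.symm
  obtain ⟨j, hj⟩ : ∃ k : ℤ, V z = exp k := ⟨_, (exp_log hz0).symm⟩
  rw [hj, ← exp_nsmul, exp_inj] at h3
  have : (l : ℤ) ∣ e := ⟨j - k, by simp at h3; linarith⟩
  have := Int.natAbs_dvd_natAbs.mpr this
  have := Nat.le_of_dvd (by omega) this
  simp at this
  omega

def S7Int (p : ℕ) [Fact p.Prime] {L : Type*} [Ring L] [Algebra ℚ_[p] L] (u : L) : Prop :=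
  ∃ P : Polynomial ℚ_[p], P.Monic ∧ (∀ i, ‖P.coeff i‖ ≤ 1) ∧ Polynomial.aeval u P = 0

lemma s7_Vle (p : ℕ) [Fact p.Prime] {L : Type*} [Field L] [Algebra ℚ_[p] L]
    (V : Valuation L ℤᵐ⁰) (hV : V (p : L) < 1) (u : L) (hu : S7Int p u) : V u ≤ 1 := by
  obtain ⟨P, hP, hc, h0⟩ := hu
  by_contra! h
  rw [Polynomial.aeval_eq_sum_range, Finset.sum_range_succ, hP.coeff_natDegree, one_smul] at h0
  have h1 := eq_neg_of_add_eq_zero_right h0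
  have h2 : V (∑ i ∈ Finset.range P.natDegree, P.coeff i • u ^ i) < V u ^ P.natDegree := by
    apply Valuation.map_sum_lt
    · exact pow_ne_zero _ (by intro h0; simp [h0] at h)
    · intro i hi
      rw [Algebra.smul_def, map_mul, map_pow]
      have := s7_Vint p (V.comap (algebraMap ℚ_[p] L)) (by simpa using hV) _ (hc i)
      calc _ ≤ 1 * V u ^ i := mul_le_mul_left this _
        _ = V u ^ i := one_mul _
        _ < _ := pow_lt_pow_right₀ h (by simpa using hi)
  rw [← map_pow, h1, Valuation.map_neg] at h2
  exact lt_irrefl _ h2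

lemma s7_int (p : ℕ) [Fact p.Prime] {L : Type*} [Field L] [Algebra ℚ_[p] L]
    [FiniteDimensional ℚ_[p] L]
    (V : Valuation L ℤᵐ⁰) (hV : V (p : L) < 1) (u : L) (hu : V u ≤ 1) : S7Int p u := by
  have key : ∀ y : L, spectralNorm ℚ_[p] L y ≤ 1 → S7Int p y := fun y hy => by
    have hm := minpoly.monic (Algebra.IsIntegral.isIntegral (R := ℚ_[p]) y)
    exact ⟨minpoly ℚ_[p] y, hm, (spectralValue_le_one_iff hm).mp hy, minpoly.aeval _ _⟩
  by_contra hcon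
  have h1 : 1 < spectralNorm ℚ_[p] L u := by
    by_contra! h; exact hcon (key u h)
  have hmul : ∀ x, spectralMulAlgNorm ℚ_[p] L x = spectralNorm ℚ_[p] L x := fun _ => rfl
  rw [← hmul] at h1
  obtain ⟨k, hk⟩ := pow_unbounded_of_one_lt (p : ℝ) h1
  have hp0 : (p : L) ≠ 0 := by
    have : CharZero L := charZero_of_injective_algebraMap (algebraMap ℚ_[p] L).injective
    exact_mod_cast (Fact.out : p.Prime).ne_zero
  have hu0 : u ≠ 0 := by rintro rfl; simp at h1; linarith
  have h2 : S7Int p ((p : L)⁻¹ * (u ^ k)⁻¹) := by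
    apply key
    rw [← hmul, map_mul, map_inv₀, map_inv₀, map_pow]
    have : spectralMulAlgNorm ℚ_[p] L (p : L) = (p : ℝ)⁻¹ := by
      rw [hmul]
      have := spectralNorm_extends (K := ℚ_[p]) (L := L) (p : ℚ_[p])
      rw [map_natCast] at this
      rw [this, Padic.norm_p]
    rw [this, inv_inv, ← div_eq_mul_inv]
    exact (div_le_one (by positivity)).mpr hk.le
  have h3 := s7_Vle p V hV _ h2
  rw [map_mul, map_inv₀, map_inv₀, map_pow] at h3
  have hVp : V (p:L) ≠ 0 := (Valuation.ne_zero_iff _).mpr hp0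
  have hVu : V u ≠ 0 := (Valuation.ne_zero_iff _).mpr hu0
  have h4 : 1 ≤ (V u ^ k)⁻¹ := (one_le_inv₀ (pow_pos (zero_lt_iff.mpr hVu) _)).mpr (pow_le_one' hu _)
  have h5 : 1 < (V (p:L))⁻¹ := (one_lt_inv₀ (zero_lt_iff.mpr hVp)).mpr hV
  exact absurd h3 (not_le.mpr (h5.trans_le (le_mul_of_one_le_right' h4)))
end A

section B
open scoped ENNReal NNReal
variable (p : ℕ) [Fact p.Prime] {T : Type*} [AddCommGroup T] [Module ℚ_[p] T]
  [FiniteDimensional ℚ_[p] T] [TopologicalSpace T] [IsTopologicalAddGroup T]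
  [ContinuousSMul ℚ_[p] T] [T2Space T] [MeasurableSpace T] [BorelSpace T]
  (μ : Measure T) [μ.IsAddHaarMeasure]

lemma s7_scale (A : T ≃ₗ[ℚ_[p]] T) : ∃ c : ℝ≥0, ∀ s, μ (A '' s) = c * μ s := by
  let φ := (Module.finBasis ℚ_[p] T).equivFun.toContinuousLinearEquiv
  have : LocallyCompactSpace T := φ.toHomeomorph.isClosedEmbedding.locallyCompactSpace
  have : SecondCountableTopology T := φ.toHomeomorph.secondCountableTopology
  let B := A.symm.toContinuousLinearEquiv
  refine ⟨Measure.addHaarScalarFactor (μ.map B) μ, fun s => ?_⟩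
  have h := Measure.isAddLeftInvariant_eq_smul (μ.map B) μ
  have h2 := congrArg (fun m : Measure T => m s) h
  simp only [Measure.smul_apply] at h2
  have h3 : (μ.map B) s = μ (B ⁻¹' s) := B.toHomeomorph.toMeasurableEquiv.map_apply s
  have h4 : A '' s = B ⁻¹' s := A.toEquiv.image_eq_preimage_symm s
  rw [h4, ← h3, h2]
  rfl

def s7box {m : ℕ} (b : Module.Basis (Fin m) ℚ_[p] T) : Set T := {x | ∀ i, ‖b.equivFun x i‖ ≤ 1}

lemma s7box_compact {m : ℕ} (b : Module.Basis (Fin m) ℚ_[p] T) : IsCompact (s7box p b) := by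
  let φ := b.equivFun.toContinuousLinearEquiv
  have h : IsCompact (Set.univ.pi fun _ : Fin m => Metric.closedBall (0 : ℚ_[p]) 1) :=
    isCompact_univ_pi fun _ => isCompact_closedBall _ _
  have := φ.toHomeomorph.isCompact_preimage.mpr h
  convert this using 1
  ext x
  simp [s7box, φ]

lemma s7box_open {m : ℕ} (b : Module.Basis (Fin m) ℚ_[p] T) : IsOpen (s7box p b) := by
  let φ := b.equivFun.toContinuousLinearEquiv
  have h : IsOpen (Set.univ.pi fun _ : Fin m => Metric.closedBall (0 : ℚ_[p]) 1) :=
    isOpen_set_pi Set.finite_univ fun _ _ => IsUltrametricDist.isOpen_closedBall _ one_ne_zero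
  have := h.preimage φ.continuous
  convert this using 1
  ext x
  simp [s7box, φ]

lemma s7_unit (A : T ≃ₗ[ℚ_[p]] T) (hA : S7Int p (A : Module.End ℚ_[p] T))
    (c : ℝ≥0) (hc : ∀ s, μ (A '' s) = c * μ s) : c ≤ 1 := by
  obtain ⟨P, hP, hcoef, h0⟩ := hA
  let f : Module.End ℚ_[p] T := A
  let b := Module.finBasis ℚ_[p] T
  let C : Set T := ⋂ k ∈ Finset.range (P.natDegree + 1), (f ^ k) ⁻¹' s7box p b
  have hCo : IsOpen C := isOpen_biInter_finset fun k _ =>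
    (s7box_open p b).preimage (LinearMap.continuous_of_finiteDimensional (f ^ k))
  have hCsub : C ⊆ s7box p b := fun x hx => by
    have := Set.mem_iInter₂.mp hx 0 (by simp)
    simpa using this
  have hCfin : μ C ≠ ∞ := ((measure_mono hCsub).trans_lt (s7box_compact p b).measure_lt_top).ne
  have hC0 : μ C ≠ 0 := by
    refine (hCo.measure_pos μ ⟨0, ?_⟩).ne'
    simp [C, s7box]
  have hst : A '' C ⊆ C := by
    rintro _ ⟨x, hx, rfl⟩
    refine Set.mem_iInter₂.mpr fun k hk => ?_
    have hk' : k < P.natDegree + 1 := by simpa using hk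
    have e1 : (f ^ k) (A x) = (f ^ (k + 1)) x := by
      rw [pow_succ]; rfl
    rw [Set.mem_preimage, e1]
    have hx' : ∀ j < P.natDegree + 1, (f ^ j) x ∈ s7box p b := fun j hj =>
      Set.mem_iInter₂.mp hx j (by simpa using hj)
    rcases Nat.lt_or_ge (k + 1) (P.natDegree + 1) with h | h
    · exact hx' _ h
    · have hkk : k = P.natDegree := by omega
      have h1 : Polynomial.aeval f (P * Polynomial.X) = 0 := by
        rw [map_mul]
        erw [h0]
        rw [zero_mul]
      have h2 : (f ^ (P.natDegree + 1)) x =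
          - ∑ i ∈ Finset.range P.natDegree, P.coeff i • (f ^ (i + 1)) x := by
        rw [map_mul, Polynomial.aeval_X, Polynomial.aeval_eq_sum_range, Finset.sum_range_succ,
          hP.coeff_natDegree, one_smul, add_mul, Finset.sum_mul, ← pow_succ] at h1
        have h3 := LinearMap.congr_fun (eq_neg_of_add_eq_zero_right h1) x
        rw [h3]
        simp [LinearMap.sum_apply, pow_succ]
      rw [hkk, h2]
      intro i
      rw [map_neg, map_sum, Pi.neg_apply, norm_neg, Finset.sum_apply]
      refine IsUltrametricDist.norm_sum_le_of_forall_le_of_nonneg zero_le_one fun j hj => ?_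
      rw [map_smul, Pi.smul_apply, smul_eq_mul, norm_mul]
      exact mul_le_one₀ (hcoef j) (norm_nonneg _) (hx' (j + 1) (by simpa using hj) i)
  have h := measure_mono (μ := μ) hst
  rw [hc] at h
  by_contra! hcon
  have : (1 : ℝ≥0∞) < c := by exact_mod_cast hcon
  have h5 := ENNReal.mul_lt_mul_left hC0 hCfin this
  rw [one_mul] at h5
  exact absurd h (not_le.mpr h5)

lemma s7_p (A : T ≃ₗ[ℚ_[p]] T) (hA : ∀ x, A x = (p : ℚ_[p]) • x)
    (c : ℝ≥0) (hc : ∀ s, μ (A '' s) = c * μ s) :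
    c * (p : ℝ≥0) ^ (Module.finrank ℚ_[p] T) = 1 := by
  let b := Module.finBasis ℚ_[p] T
  have hpp : p.Prime := Fact.out
  let Λ := s7box p b
  have hΛ0 : μ Λ ≠ 0 := ((s7box_open p b).measure_pos μ ⟨0, by simp [s7box]⟩).ne'
  have hΛt : μ Λ ≠ ∞ := (s7box_compact p b).measure_lt_top.ne
  let v : (Fin (Module.finrank ℚ_[p] T) → Fin p) → T := fun a =>
    b.equivFun.symm (fun i => ((a i : ℕ) : ℚ_[p]))
  have hmem : ∀ y, y ∈ A '' Λ ↔ ∀ i, ‖b.equivFun y i‖ < 1 := by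
    intro y
    have hnp : ∀ z : ℚ_[p], ‖(p : ℚ_[p]) * z‖ < 1 ↔ ‖z‖ ≤ 1 := fun z => by
      have := Padic.norm_le_pow_iff_norm_lt_pow_add_one z 0
      simp only [zpow_zero, zero_add, zpow_one] at this
      rw [this, norm_mul, Padic.norm_p, inv_mul_lt_iff₀ (by exact_mod_cast hpp.pos), mul_one]
    constructor
    · rintro ⟨x, hx, rfl⟩ i
      rw [hA, map_smul, Pi.smul_apply, smul_eq_mul, hnp]
      exact hx i
    · intro h
      refine ⟨A.symm y, fun i => ?_, A.apply_symm_apply y⟩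
      rw [← hnp]
      have : b.equivFun (A (A.symm y)) i = (p : ℚ_[p]) * b.equivFun (A.symm y) i := by
        rw [hA, map_smul, Pi.smul_apply, smul_eq_mul]
      rw [← this, A.apply_symm_apply]
      exact h i
  have hU : Λ = ⋃ a, (fun x => v a + x) '' (A '' Λ) := by
    ext x
    simp only [Set.mem_iUnion, Set.image_add_left, Set.mem_preimage, hmem]
    constructor
    · intro hx
      refine ⟨fun i => ⟨PadicInt.zmodRepr ⟨_, hx i⟩, PadicInt.zmodRepr_lt_p _⟩, fun i => ?_⟩
      have := PadicInt.norm_sub_zmodRepr_lt_one ⟨b.equivFun x i, hx i⟩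
      rw [PadicInt.norm_def] at this
      push_cast at this
      rw [map_add, map_neg, LinearEquiv.apply_symm_apply, Pi.add_apply, Pi.neg_apply,
        neg_add_eq_sub]
      exact this
    · rintro ⟨a, ha⟩ i
      have h1 := ha i
      rw [map_add, map_neg, LinearEquiv.apply_symm_apply, Pi.add_apply, Pi.neg_apply,
        neg_add_eq_sub] at h1
      have := IsUltrametricDist.norm_add_le_max (b.equivFun x i - ((a i : ℕ) : ℚ_[p]))
        ((a i : ℕ) : ℚ_[p])
      rw [sub_add_cancel] at this
      exact this.trans (max_le h1.le (by exact_mod_cast Padic.norm_int_le_one (a i : ℕ)))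
  have hdisj : Pairwise (Function.onFun Disjoint fun a => (fun x => v a + x) '' (A '' Λ)) := by
    intro a a' haa
    rw [Function.onFun, Set.disjoint_left]
    intro x hx hx'
    simp only [Set.image_add_left, Set.mem_preimage, hmem] at hx hx'
    apply haa
    funext i
    have h1 := hx i
    have h2 := hx' i
    rw [map_add, map_neg, LinearEquiv.apply_symm_apply, Pi.add_apply, Pi.neg_apply,
        neg_add_eq_sub] at h1 h2
    have h3 : ‖((((a i : ℕ) : ℤ) - ((a' i : ℕ) : ℤ) : ℤ) : ℚ_[p])‖ < 1 := by
      have := IsUltrametricDist.norm_add_le_max (b.equivFun x i - ((a' i : ℕ) : ℚ_[p]))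
        (-(b.equivFun x i - ((a i : ℕ) : ℚ_[p])))
      rw [norm_neg, ← sub_eq_add_neg, sub_sub_sub_cancel_left] at this
      push_cast
      exact this.trans_lt (max_lt h2 h1)
    rw [Padic.norm_intCast_lt_one_iff] at h3
    have h5 : ((a' i : ℕ)) ≡ (a i : ℕ) [MOD p] := (Nat.modEq_iff_dvd).mpr h3
    ext
    exact (Nat.ModEq.eq_of_lt_of_lt h5 (a' i).2 (a i).2).symm
  have hAo : IsOpen (A '' Λ) := by
    have := A.toContinuousLinearEquiv.toHomeomorph.isOpenMap _ (s7box_open p b)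
    exact this
  have h := measure_iUnion (μ := μ) hdisj
    (fun a => ((isOpenMap_add_left (v a)) _ hAo).measurableSet)
  rw [← hU] at h
  simp only [Set.image_add_left, measure_preimage_add, tsum_fintype, Finset.sum_const, hc] at h
  simp at h
  have h6 : (c * (p : ℝ≥0∞) ^ (Module.finrank ℚ_[p] T)) * μ Λ = 1 * μ Λ := by
    rw [one_mul]; conv_rhs => rw [h]
    ring
  have h7 := (ENNReal.mul_left_inj hΛ0 hΛt).mp h6
  exact_mod_cast h7

lemma s7_B {L : Type*} [Field L] [Algebra ℚ_[p] L] (ρ : L →ₐ[ℚ_[p]] Module.End ℚ_[p] T)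
    (U : Set T) (hU : μ U = 1) (t : L) (ht : t ≠ 0) (e : ℕ) (n : ℤ)
    (h1 : S7Int p (t ^ e * ((p : L) ^ n)⁻¹)) (h2 : S7Int p (t ^ e * ((p : L) ^ n)⁻¹)⁻¹) :
    (e : ℝ) * Real.log (μ (ρ t '' U)).toReal =
      - (n * Module.finrank ℚ_[p] T * Real.log p) := by
  have hpp : p.Prime := Fact.out
  have hchar : CharZero L := charZero_of_injective_algebraMap (algebraMap ℚ_[p] L).injective
  have hp0 : (p : L) ≠ 0 := by exact_mod_cast hpp.ne_zero
  let E : Lˣ →* (T ≃ₗ[ℚ_[p]] T) :=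
    (LinearMap.GeneralLinearGroup.generalLinearEquiv ℚ_[p] T).toMonoidHom.comp
      (Units.map (ρ : L →* Module.End ℚ_[p] T))
  have hE : ∀ u x, E u x = ρ u x := fun u x => rfl
  choose c hc using fun u => s7_scale p μ (E u)
  have hmul : ∀ u w, c (u * w) = c u * c w := fun u w => by
    have e1 := hc (u * w) U
    have e2 : (E (u * w)) '' U = E u '' (E w '' U) := by
      rw [map_mul, ← Set.image_comp]; rfl
    rw [e2, hc, hc, hU] at e1
    simp only [mul_one] at e1
    exact_mod_cast e1.symm
  have hone : c 1 = 1 := by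
    have e1 := hc 1 U
    have e2 : (E 1) '' U = U := by
      rw [map_one]; exact Set.image_id U
    rw [e2, hU, mul_one] at e1
    exact_mod_cast e1.symm
  let ch : Lˣ →* ℝ≥0 := { toFun := c, map_one' := hone, map_mul' := hmul }
  have hint : ∀ u : Lˣ, S7Int p (u : L) → ch u ≤ 1 := by
    rintro u ⟨P, hP, hcf, h0⟩
    refine s7_unit p μ (E u) ⟨P, hP, hcf, ?_⟩ (c u) (hc u)
    have : ((E u : T ≃ₗ[ℚ_[p]] T) : Module.End ℚ_[p] T) = ρ u := rfl
    rw [this, Polynomial.aeval_algHom_apply, h0, map_zero]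
  let tu := Units.mk0 t ht
  let pu := Units.mk0 (p : L) hp0
  have hu1 : ch (tu ^ e * (pu ^ n)⁻¹) ≤ 1 := hint _ (by simpa [tu, pu] using h1)
  have hu2 : ch (tu ^ e * (pu ^ n)⁻¹)⁻¹ ≤ 1 := hint _ (by simpa [tu, pu] using h2)
  have hpc : ch pu * (p : ℝ≥0) ^ (Module.finrank ℚ_[p] T) = 1 := by
    refine s7_p p μ (E pu) (fun x => ?_) _ (hc pu)
    rw [hE]
    have : ((pu : Lˣ) : L) = algebraMap ℚ_[p] L p := by simp [pu]
    rw [this, AlgHom.commutes]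
    rfl
  have hinv : ch (tu ^ e * (pu ^ n)⁻¹) * ch (tu ^ e * (pu ^ n)⁻¹)⁻¹ = 1 := by
    rw [← map_mul, mul_inv_cancel, map_one]
  have hu : ch (tu ^ e * (pu ^ n)⁻¹) = 1 := by
    refine le_antisymm hu1 ?_
    rw [← hinv]
    exact mul_le_of_le_one_right' hu2
  have hfin : ch tu ^ e = ch pu ^ n := by
    have h3 : tu ^ e = (tu ^ e * (pu ^ n)⁻¹) * pu ^ n := by simp
    have h4 := congrArg ch h3
    rw [map_mul, hu, one_mul, map_pow] at h4
    rw [h4]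
    exact map_zpow' (Units.coeHom ℝ≥0 |>.comp ch.toHomUnits) (fun _ => by simp) pu n
  have hval : (μ (ρ t '' U)).toReal = (ch tu : ℝ) := by
    have : μ (ρ t '' U) = c tu * μ U := hc tu U
    rw [this, hU, mul_one]; rfl
  have hl1 := congrArg (fun x : ℝ≥0 => Real.log x) hfin
  have hl2 := congrArg (fun x : ℝ≥0 => Real.log x) hpc
  have hcp : (ch pu : ℝ) ≠ 0 := by
    intro h; have : ch pu = 0 := by exact_mod_cast h
    simp [this] at hpc
  have hppos : (p : ℝ) ≠ 0 := by exact_mod_cast hpp.ne_zero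
  push_cast at hl1 hl2
  rw [Real.log_pow, Real.log_zpow] at hl1
  rw [Real.log_mul hcp (pow_ne_zero _ hppos), Real.log_pow, Real.log_one] at hl2
  rw [hval, hl1, eq_neg_of_add_eq_zero_left hl2]
  ring

end B

section C
open WithZero
variable (p : ℕ) [Fact p.Prime] (F : Type*) [Field F] [NumberField F]

lemma s7_Vp (v : HeightOneSpectrum (𝓞 F)) :
    Valued.v (p : v.adicCompletion F) =
      (exp (-(Ideal.ramificationIdx' (Ideal.span {(p : ℤ)}) v.asIdeal : ℤ)) : ℤᵐ⁰) := by
  have hpp : p.Prime := Fact.out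
  have hp0 : ((p : ℤ) : 𝓞 F) ≠ 0 := by exact_mod_cast hpp.ne_zero
  have e1 : ∀ n : ℕ, (n : v.adicCompletion F) = (((n : F)) : v.adicCompletion F) := by
    intro n
    induction n with
    | zero => rw [Nat.cast_zero, Nat.cast_zero]; exact (HeightOneSpectrum.adicCompletion.coe_zero F v).symm
    | succ n ih =>
      rw [Nat.cast_succ, Nat.cast_succ, ih]
      apply HeightOneSpectrum.adicCompletion.ext
      simp [UniformSpace.Completion.coe_add]
      rfl
  have hm : Ideal.map (algebraMap ℤ (𝓞 F)) (Ideal.span {(p : ℤ)}) = Ideal.span {((p : ℤ) : 𝓞 F)} := by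
    rw [Ideal.map_span]; simp
  have hne : Ideal.map (algebraMap ℤ (𝓞 F)) (Ideal.span {(p : ℤ)}) ≠ ⊥ := by
    rw [hm]; simpa using hpp.ne_zero
  have h2 : v.valuation F (p : F) = v.intValuation (p : 𝓞 F) := by
    rw [← HeightOneSpectrum.valuation_of_algebraMap (K := F)]
    simp
  rw [e1, HeightOneSpectrum.adicCompletion.valued_ofCompletion]
  refine (HeightOneSpectrum.adicCompletion.valued_coe (K := F) (v := v) (p : F)).trans ?_
  rw [h2,
    HeightOneSpectrum.intValuation_eq_exp_neg_multiplicity _ (by exact_mod_cast hp0),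
    Ideal.IsDedekindDomain.ramificationIdx'_eq_multiplicity hne v.isPrime, hm]
  simp

set_option linter.deprecated false in
lemma s7_sum (Vp : Finset (HeightOneSpectrum (𝓞 F)))
    (hVp : ∀ v : HeightOneSpectrum (𝓞 F), v ∈ Vp ↔ ((p : ℤ) : 𝓞 F) ∈ v.asIdeal) :
    ∑ v ∈ Vp, Ideal.ramificationIdx' (Ideal.span {(p : ℤ)}) v.asIdeal *
        Ideal.inertiaDeg' (Ideal.span {(p : ℤ)}) v.asIdeal = Module.finrank ℚ F := by
  have hpp : Prime (p : ℤ) := Nat.prime_iff_prime_int.mp Fact.out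
  have hne : Ideal.span {(p : ℤ)} ≠ ⊥ := by simpa using hpp.ne_zero
  have : (Ideal.span {(p : ℤ)}).IsMaximal :=
    ((Ideal.span_singleton_prime hpp.ne_zero).mpr hpp).isMaximal hne
  rw [← Ideal.sum_ramification_inertia (𝓞 F) ℚ F hne]
  refine Finset.sum_bij (fun v _ => v.asIdeal) ?_ ?_ ?_ ?_
  · intro v hv
    rw [IsDedekindDomain.mem_primesOverFinset_iff hne]
    refine ⟨v.isPrime, ?_⟩
    rw [Ideal.liesOver_iff]
    refine this.eq_of_le (Ideal.IsPrime.under _ _).ne_top ?_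
    rw [Ideal.span_singleton_le_iff_mem]
    simpa [Ideal.under] using (hVp v).mp hv
  · intro a _ b _ h
    exact HeightOneSpectrum.ext h
  · intro P hP
    rw [IsDedekindDomain.mem_primesOverFinset_iff hne] at hP
    obtain ⟨h1, h2⟩ := hP
    have hmem : ((p : ℤ) : 𝓞 F) ∈ P := by
      have : (p : ℤ) ∈ P.under ℤ := by rw [← h2.over]; exact Ideal.mem_span_singleton_self _
      simpa [Ideal.under] using this
    refine ⟨⟨P, h1, ?_⟩, (hVp _).mpr hmem, rfl⟩
    rintro rfl
    simp at hmem
    exact (Fact.out : p.Prime).ne_zero hmem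
  · intros; rfl

lemma s7_pos (v : HeightOneSpectrum (𝓞 F)) (hv : ((p : ℤ) : 𝓞 F) ∈ v.asIdeal) :
    Ideal.ramificationIdx' (Ideal.span {(p : ℤ)}) v.asIdeal ≠ 0 ∧
    Ideal.absNorm v.asIdeal = p ^ Ideal.inertiaDeg' (Ideal.span {(p : ℤ)}) v.asIdeal := by
  have hpp : Prime (p : ℤ) := Nat.prime_iff_prime_int.mp Fact.out
  have hne : Ideal.span {(p : ℤ)} ≠ ⊥ := by simpa using hpp.ne_zero
  have : (Ideal.span {(p : ℤ)}).IsMaximal :=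
    ((Ideal.span_singleton_prime hpp.ne_zero).mpr hpp).isMaximal hne
  have hlo : v.asIdeal.LiesOver (Ideal.span {(p : ℤ)}) := by
    have := v.isPrime
    rw [Ideal.liesOver_iff]
    refine Ideal.IsMaximal.eq_of_le ‹_› (Ideal.IsPrime.under _ _).ne_top ?_
    rw [Ideal.span_singleton_le_iff_mem]
    simpa [Ideal.under] using hv
  refine ⟨?_, ?_⟩
  · have hm : Ideal.map (algebraMap ℤ (𝓞 F)) (Ideal.span {(p : ℤ)}) =
        Ideal.span {((p : ℤ) : 𝓞 F)} := by
      rw [Ideal.map_span]; simp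
    refine Ideal.IsDedekindDomain.ramificationIdx'_ne_zero ?_ v.isPrime ?_
    · rw [hm]; simpa using (Fact.out : p.Prime).ne_zero
    · rw [hm, Ideal.span_singleton_le_iff_mem]; exact hv
  · have := Ideal.absNorm_eq_pow_inertiaDeg' v.asIdeal (Fact.out : p.Prime)
    exact this
end C

section D

lemma s7_local (p : ℕ) [Fact p.Prime] (F : Type*) [Field F] [NumberField F]
    (v : HeightOneSpectrum (𝓞 F)) (hv : ((p : ℤ) : 𝓞 F) ∈ v.asIdeal)
    {L : Type*} [Field L] [Algebra ℚ_[p] L] [FiniteDimensional ℚ_[p] L]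
    (iso : L ≃+* v.adicCompletion F) (t : L) (n : ℤ)
    (hn : Valued.v (iso t) =
      ((Multiplicative.ofAdd (-n) : Multiplicative ℤ) : WithZero (Multiplicative ℤ)))
    {T : Type*} [AddCommGroup T] [Module ℚ_[p] T]
    [FiniteDimensional ℚ_[p] T] [TopologicalSpace T] [IsTopologicalAddGroup T]
    [ContinuousSMul ℚ_[p] T] [T2Space T] [MeasurableSpace T] [BorelSpace T] [Nontrivial T]
    (μ : Measure T) [μ.IsAddHaarMeasure] (ρ : L →ₐ[ℚ_[p]] Module.End ℚ_[p] T)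
    (U : Set T) (hU : μ U = 1) (ht : t ≠ 0) :
    ((Ideal.ramificationIdx' (Ideal.span {(p : ℤ)}) v.asIdeal *
        Ideal.inertiaDeg' (Ideal.span {(p : ℤ)}) v.asIdeal : ℕ) : ℝ) *
      (Real.log (μ (ρ t '' U)).toReal / (Module.finrank ℚ_[p] T : ℝ)) =
      - (n * Real.log (Ideal.absNorm v.asIdeal : ℝ)) := by
  obtain ⟨he, hN⟩ := s7_pos p F v hv
  set e := Ideal.ramificationIdx' (Ideal.span {(p : ℤ)}) v.asIdeal with hedef
  have hVp := s7_Vp p F v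
  rw [← hedef] at hVp
  let V : Valuation L (WithZero (Multiplicative ℤ)) :=
    (Valued.v : Valuation (v.adicCompletion F) (WithZero (Multiplicative ℤ))).comap
      (iso : L →+* v.adicCompletion F)
  have hV : V (p : L) = WithZero.exp (-(e : ℤ)) := by
    rw [← hVp]; simp [V]
  have hVt : V t = WithZero.exp (-n) := hn
  have hlt : V (p : L) < 1 := by
    rw [hV, ← WithZero.exp_zero, WithZero.exp_lt_exp]; omega
  have hVu : V (t ^ e * ((p : L) ^ n)⁻¹) = 1 := by
    rw [map_mul, map_inv₀, map_pow, map_zpow₀, hV, hVt, ← WithZero.exp_nsmul,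
      ← WithZero.exp_zsmul, ← WithZero.exp_neg, ← WithZero.exp_add, ← WithZero.exp_zero]
    congr 1
    simp
    ring
  have h1 := s7_int p V hlt _ hVu.le
  have h2 := s7_int p V hlt (t ^ e * ((p : L) ^ n)⁻¹)⁻¹ (by rw [map_inv₀, hVu, inv_one])
  have h := s7_B p μ ρ U hU t ht e n h1 h2
  have hd : (Module.finrank ℚ_[p] T : ℝ) ≠ 0 := by
    exact_mod_cast (Module.finrank_pos (R := ℚ_[p]) (M := T)).ne'
  rw [hN]
  push_cast
  rw [Real.log_pow]
  field_simp
  linear_combination (Ideal.inertiaDeg' (Ideal.span {(p : ℤ)}) v.asIdeal : ℝ) * h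

lemma s7_expect {α : Type*} [Fintype α] (k : ℕ) (w g : α → ℝ) (hw : ∑ a, w a = 1) :
    ∑ vs : Fin (k + 1) → α, (∏ i, w (vs i)) * g (vs (Fin.last k)) = ∑ a, w a * g a := by
  classical
  have h := Fintype.prod_sum (fun (i : Fin (k + 1)) (a : α) =>
    w a * (if i = Fin.last k then g a else 1))
  rw [Fin.prod_univ_castSucc] at h
  simp only [Fin.castSucc_ne_last, if_false, if_true, mul_one, hw, Finset.prod_const_one,
    one_mul] at h
  rw [h]
  refine Finset.sum_congr rfl fun vs _ => ?_
  rw [Finset.prod_mul_distrib]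
  simp

end D

/-- Let `p` be a prime, `F₀` a number field, `V_p` the set of places of
`F₀` above `p`, weighted by `Pr(v) = [F₀ᵥ : ℚ_p]/[F₀ : ℚ]` (the local degree
`d v = e·f`); these weights sum to `1`.  Fix `r ≥ 1` and, for each `v ∈ V_p`, an element
`t v ∈ F₀ᵥˣ` of normalized valuation `n v` (here `L v`, a finite extension of `ℚ_p`, is
identified with the completion `F₀ᵥ` via `iso`).  For each tuple `vs ∈ V_p^r` let
`T_{vs} = F₀_{v₀} ⊗[ℚ_p] ⋯ ⊗[ℚ_p] F₀_{v_{r−1}}` carry its natural topology, a Haar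
measure `μ_{vs}`, and a measurable set `U_{vs}` of measure `1`, and let `t_{v_{r−1}}`
act through the last tensor factor.  Then
`Σ_{vs} Pr(vs) · (log μ_{vs}(t_{v_{r−1}}·U_{vs})/dim T_{vs})
  = −(1/[F₀:ℚ]) Σ_{v ∈ V_p} n v · log|κ(v)|`. -/
theorem stmt_7 (p : ℕ) [Fact p.Prime] (F : Type*) [Field F] [NumberField F]
    (Vp : Finset (HeightOneSpectrum (𝓞 F)))
    (hVp : ∀ v : HeightOneSpectrum (𝓞 F), v ∈ Vp ↔ ((p : ℤ) : 𝓞 F) ∈ v.asIdeal)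
    (d : HeightOneSpectrum (𝓞 F) → ℕ)
    (hd : ∀ v, d v =
      Ideal.ramificationIdx' (Ideal.span {(p : ℤ)}) v.asIdeal *
        Ideal.inertiaDeg' (Ideal.span {(p : ℤ)}) v.asIdeal)
    (L : HeightOneSpectrum (𝓞 F) → Type*)
    [∀ v, Field (L v)] [∀ v, Algebra ℚ_[p] (L v)] [∀ v, FiniteDimensional ℚ_[p] (L v)]
    (iso : ∀ v ∈ Vp, L v ≃+* v.adicCompletion F)
    (hdim : ∀ v ∈ Vp, Module.finrank ℚ_[p] (L v) = d v)
    (r : ℕ) (hr : 1 ≤ r)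
    (t : ∀ v, L v) (ht : ∀ v ∈ Vp, t v ≠ 0)
    (n : HeightOneSpectrum (𝓞 F) → ℤ)
    (hn : ∀ (v) (hv : v ∈ Vp), Valued.v (iso v hv (t v)) =
      ((Multiplicative.ofAdd (-(n v)) : Multiplicative ℤ) : WithZero (Multiplicative ℤ)))
    [∀ vs : Fin r → {v // v ∈ Vp}, TopologicalSpace (⨂[ℚ_[p]] i, L (vs i).1)]
    [∀ vs : Fin r → {v // v ∈ Vp}, IsTopologicalAddGroup (⨂[ℚ_[p]] i, L (vs i).1)]
    [∀ vs : Fin r → {v // v ∈ Vp}, ContinuousSMul ℚ_[p] (⨂[ℚ_[p]] i, L (vs i).1)]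
    [∀ vs : Fin r → {v // v ∈ Vp}, T2Space (⨂[ℚ_[p]] i, L (vs i).1)]
    [∀ vs : Fin r → {v // v ∈ Vp}, MeasurableSpace (⨂[ℚ_[p]] i, L (vs i).1)]
    [∀ vs : Fin r → {v // v ∈ Vp}, BorelSpace (⨂[ℚ_[p]] i, L (vs i).1)]
    (μ : ∀ vs : Fin r → {v // v ∈ Vp}, Measure (⨂[ℚ_[p]] i, L (vs i).1))
    [∀ vs, (μ vs).IsAddHaarMeasure]
    (U : ∀ vs : Fin r → {v // v ∈ Vp}, Set (⨂[ℚ_[p]] i, L (vs i).1))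
    (hUmeas : ∀ vs, MeasurableSet (U vs)) (hU : ∀ vs, μ vs (U vs) = 1) :
    (∑ v ∈ Vp, (d v : ℝ) / (Module.finrank ℚ F : ℝ) = 1) ∧
    ∑ vs : Fin r → {v // v ∈ Vp},
        (∏ i : Fin r, ((d (vs i).1 : ℝ) / (Module.finrank ℚ F : ℝ))) *
          (Real.log ((μ vs
              ((PiTensorProduct.map (fun i : Fin r =>
                if (i : ℕ) = r - 1 then
                  (Algebra.lmul ℚ_[p] (L (vs i).1)) (t (vs i).1)
                else LinearMap.id)) '' (U vs))).toReal) /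
            (Module.finrank ℚ_[p] (⨂[ℚ_[p]] i, L (vs i).1) : ℝ)) =
      -(1 / (Module.finrank ℚ F : ℝ)) *
        ∑ v ∈ Vp, (n v : ℝ) * Real.log (Ideal.absNorm v.asIdeal : ℝ) := by
  classical
  have hfin : (Module.finrank ℚ F : ℝ) ≠ 0 := by
    exact_mod_cast (Module.finrank_pos (R := ℚ) (M := F)).ne'
  have hsum : ∑ v ∈ Vp, (d v : ℝ) / (Module.finrank ℚ F : ℝ) = 1 := by
    rw [← Finset.sum_div, div_eq_one_iff_eq hfin, ← s7_sum p F Vp hVp]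
    push_cast
    refine Finset.sum_congr rfl fun v _ => ?_
    rw [hd v]; push_cast; rfl
  refine ⟨hsum, ?_⟩
  obtain ⟨k, rfl⟩ : ∃ k, r = k + 1 := ⟨r - 1, by omega⟩
  have hsum' : ∑ v : {v // v ∈ Vp}, (d v.1 : ℝ) / (Module.finrank ℚ F : ℝ) = 1 := by
    rw [← hsum]
    exact Finset.sum_coe_sort Vp (fun v => (d v : ℝ) / (Module.finrank ℚ F : ℝ))
  have hdpos : ∀ v ∈ Vp, (d v : ℝ) ≠ 0 := fun v hv => by
    rw [← hdim v hv]
    exact_mod_cast (Module.finrank_pos (R := ℚ_[p]) (M := L v)).ne'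
  have key : ∀ vs : Fin (k + 1) → {v // v ∈ Vp},
      Real.log ((μ vs
              ((PiTensorProduct.map (fun i : Fin (k + 1) =>
                if (i : ℕ) = k + 1 - 1 then
                  (Algebra.lmul ℚ_[p] (L (vs i).1)) (t (vs i).1)
                else LinearMap.id)) '' (U vs))).toReal) /
            (Module.finrank ℚ_[p] (⨂[ℚ_[p]] i, L (vs i).1) : ℝ) =
      -((n (vs (Fin.last k)).1 : ℝ) *
        Real.log (Ideal.absNorm (vs (Fin.last k)).1.asIdeal : ℝ)) / d (vs (Fin.last k)).1 := by
    intro vs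
    set v := vs (Fin.last k) with hvdef
    let ρ : L (vs (Fin.last k)).1 →ₐ[ℚ_[p]] Module.End ℚ_[p] (⨂[ℚ_[p]] i, L (vs i).1) :=
      (Algebra.lmul ℚ_[p] (⨂[ℚ_[p]] i, L (vs i).1)).comp
        (PiTensorProduct.singleAlgHom (R := ℚ_[p]) (A := fun i => L (vs i).1) (Fin.last k))
    have hmap : PiTensorProduct.map (fun i : Fin (k + 1) =>
                if (i : ℕ) = k + 1 - 1 then
                  (Algebra.lmul ℚ_[p] (L (vs i).1)) (t (vs i).1)
                else LinearMap.id) = ρ (t (vs (Fin.last k)).1) := by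
      ext x
      have e1 : ρ (t (vs (Fin.last k)).1) (PiTensorProduct.tprod ℚ_[p] x) =
          PiTensorProduct.tprod ℚ_[p]
            (MonoidHom.mulSingle (fun i => L (vs i).1) (Fin.last k) (t (vs (Fin.last k)).1)) *
            PiTensorProduct.tprod ℚ_[p] x := rfl
      rw [LinearMap.compMultilinearMap_apply, LinearMap.compMultilinearMap_apply, e1,
        PiTensorProduct.tprod_mul_tprod, PiTensorProduct.map_tprod]
      congr 1
      funext i
      by_cases hi : i = Fin.last k
      · subst hi
        simp
      · have hi' : ¬ ((i : ℕ) = k + 1 - 1) := fun h => hi (Fin.ext (by simpa using h))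
        rw [if_neg hi', Pi.mul_apply, MonoidHom.mulSingle_apply, Pi.mulSingle_eq_of_ne hi]
        simp
    have hnt : Nontrivial (⨂[ℚ_[p]] i, L (vs i).1) := by
      let B := Basis.piTensorProduct (fun i => Module.finBasis ℚ_[p] (L (vs i).1))
      apply Module.nontrivial_of_finrank_pos (R := ℚ_[p])
      rw [Module.finrank_eq_card_basis B, Fintype.card_pi]
      refine Finset.prod_pos fun i _ => ?_
      rw [Fintype.card_fin]
      exact Module.finrank_pos
    have h := s7_local p F v.1 ((hVp _).mp v.2) (iso v.1 v.2) (t v.1) (n v.1) (hn v.1 v.2)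
      (μ vs) ρ (U vs) (hU vs) (ht v.1 v.2)
    rw [← hd] at h
    rw [hmap, eq_div_iff (hdpos _ v.2), mul_comm]
    exact h
  simp_rw [key]
  have hE := s7_expect k (fun v : {v // v ∈ Vp} => (d v.1 : ℝ) / (Module.finrank ℚ F : ℝ))
    (fun v => -((n v.1 : ℝ) * Real.log (Ideal.absNorm v.1.asIdeal : ℝ)) / d v.1) hsum'
  rw [hE, Finset.mul_sum, ← Finset.sum_coe_sort Vp]
  refine Finset.sum_congr rfl fun v _ => ?_
  have := hdpos v.1 v.2
  field_simp
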